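/- For every natural number d and every k, if there exists a 1D vector sequence of length k from rest to rest with displacement d, then k ≥ ⌈2·√d⌉. -/

import Mathlib

/-- A 1D vector sequence of length `k` from rest to rest with displacement `D`:
if `k > 0` then `|v 0| ≤ 1` and `v (k-1) = 0`; consecutive vectors differ by at
most one unit; and the vectors sum to `D`. -/
def IsVecSeq (k : ℕ) (D : ℤ) (v : Fin k → ℤ) : Prop :=
  (∀ h : 0 < k, |v ⟨0, h⟩| ≤ 1 ∧ v ⟨k - 1, Nat.sub_lt h one_pos⟩ = 0) ∧
  (∀ (i : ℕ) (h : i + 1 < k), |v ⟨i + 1, h⟩ - v ⟨i, by omega⟩| ≤ 1) ∧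
  (∑ i, v i = D)

lemma sum_min_bound : ∀ k : ℕ,
    4 * ∑ i ∈ Finset.range k, min ((i : ℤ) + 1) ((k : ℤ) - 1 - i) ≤ (k : ℤ) ^ 2
  | 0 => by simp
  | 1 => by simp
  | k + 2 => by
    have ih := sum_min_bound k
    rw [Finset.sum_range_succ, Finset.sum_range_succ']
    have h1 : ∑ i ∈ Finset.range k, min (((i + 1 : ℕ) : ℤ) + 1) (((k + 2 : ℕ) : ℤ) - 1 - ((i + 1 : ℕ) : ℤ))
        = ∑ i ∈ Finset.range k, (min ((i : ℤ) + 1) ((k : ℤ) - 1 - i) + 1) := by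
      apply Finset.sum_congr rfl
      intro i _
      push_cast
      omega
    rw [h1, Finset.sum_add_distrib]
    have h2 : min (((0 : ℕ) : ℤ) + 1) (((k + 2 : ℕ) : ℤ) - 1 - ((0 : ℕ) : ℤ)) = 1 := by
      push_cast
      omega
    have h3 : min (((k + 1 : ℕ) : ℤ) + 1) (((k + 2 : ℕ) : ℤ) - 1 - ((k + 1 : ℕ) : ℤ)) = 0 := by
      push_cast
      omega
    rw [h2, h3]
    simp only [Finset.sum_const, Finset.card_range, nsmul_eq_mul, mul_one]
    push_cast
    nlinarith

/-- Any 1D rest-to-rest vector sequence with displacement `d` has at least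
`⌈2√d⌉` vectors. -/
theorem vtsp_one_dim_cost_lower (d k : ℕ)
    (h : ∃ v : Fin k → ℤ, IsVecSeq k (d : ℤ) v) :
    ⌈2 * Real.sqrt d⌉₊ ≤ k := by
  obtain ⟨v, h0, h1, h2⟩ := h
  have hup : ∀ (i : ℕ) (hi : i < k), v ⟨i, hi⟩ ≤ i + 1 := by
    intro i
    induction i with
    | zero =>
      intro hi
      have := (abs_le.mp (h0 hi).1).2
      simpa using this
    | succ i ih =>
      intro hi
      have a := (abs_le.mp (h1 i hi)).2
      have b := ih (by omega)
      push_cast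
      linarith
  have hdn : ∀ (j i : ℕ) (hi : i < k), i + j + 1 = k → v ⟨i, hi⟩ ≤ j := by
    intro j
    induction j with
    | zero =>
      intro i hi hk
      have := (h0 (by omega)).2
      have e : i = k - 1 := by omega
      subst e
      simp [this]
    | succ j ih =>
      intro i hi hk
      have a := (abs_le.mp (h1 i (by omega))).1
      have b := ih (i + 1) (by omega) (by omega)
      push_cast
      linarith
  have hs : (d : ℤ) ≤ ∑ i ∈ Finset.range k, min ((i : ℤ) + 1) ((k : ℤ) - 1 - i) := by
    rw [← h2, Finset.sum_range]
    apply Finset.sum_le_sum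
    rintro ⟨i, hi⟩ _
    refine le_min (hup i hi) ?_
    have := hdn (k - 1 - i) i hi (by omega)
    dsimp only
    omega
  have hb := sum_min_bound k
  have h4 : (4 * d : ℤ) ≤ (k : ℤ) ^ 2 := by linarith
  have h5 : (4 * d : ℝ) ≤ (k : ℝ) ^ 2 := by exact_mod_cast h4
  apply Nat.ceil_le.mpr
  have h6 : Real.sqrt d ≤ (k : ℝ) / 2 := Real.sqrt_le_iff.mpr ⟨by positivity, by nlinarith⟩
  linarith
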